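/- arXiv:2107.06248 — 2 statements merged into one kernel-verified Lean document; each statement's English description precedes it below -/
import Mathlib

section
/- There exists an absolute constant α > 0 such that for every natural number k ≥ 1 and every subgroup H of the symmetric group G = Sym(k) whose index |G : H| is at least 3, one has |H/H'| ≤ exp( α · log|G:H| / log log |G:H| ). -/
open MulAction
open scoped commutatorElement

/-- number of orbits -/
noncomputable def norb {G : Type*} [Group G] (Ω : Type*) [MulAction G Ω] (L : Subgroup G) : ℕ :=
  Nat.card (orbitRel.Quotient L Ω)

lemma mk_eq_iff_orb {G Ω : Type*} [Group G] [MulAction G Ω] (L : Subgroup G) (x y : Ω) :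
    (Quotient.mk (orbitRel L Ω) x = Quotient.mk (orbitRel L Ω) y) ↔ ∃ l ∈ L, l • y = x := by
  rw [Quotient.eq]
  constructor
  · rintro ⟨⟨l, hl⟩, h⟩
    exact ⟨l, hl, h⟩
  · rintro ⟨l, hl, h⟩
    exact ⟨⟨l, hl⟩, h⟩

lemma step_orb {G A Ω : Type*} [Group G] [Finite G] [CommGroup A] [Finite Ω] [MulAction G Ω]
    (φ : G →* A) (L : Subgroup G) (x : Ω) :
    norb Ω L + (((L ⊓ stabilizer G x).map φ).relIndex (L.map φ)) ≤
      norb Ω (L ⊓ stabilizer G x) + 1 := by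
  classical
  set Lx := L ⊓ stabilizer G x with hLx
  set Q := (L.map φ) ⧸ ((Lx.map φ).subgroupOf (L.map φ)) with hQ
  have : Finite (L.map φ) := Finite.of_surjective (fun l : L => (⟨φ l, l, l.2, rfl⟩ : L.map φ)) (by
    rintro ⟨_, l, hl, rfl⟩; exact ⟨⟨l, hl⟩, rfl⟩)
  have hfin : Finite Q := inferInstance
  have hm : (Lx.map φ).relIndex (L.map φ) = Nat.card Q := rfl
  have hrep : ∀ c : Q, ∃ l : L, c = QuotientGroup.mk (⟨φ l, l, l.2, rfl⟩ : L.map φ) := by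
    intro c
    obtain ⟨⟨_, l, hl, rfl⟩, rfl⟩ := QuotientGroup.mk_surjective c
    exact ⟨⟨l, hl⟩, rfl⟩
  choose r hr using hrep
  let s : orbitRel.Quotient L Ω → Ω := fun o =>
    if o = Quotient.mk (orbitRel L Ω) x then x else Quotient.out o
  have hs : ∀ o, Quotient.mk (orbitRel L Ω) (s o) = o := by
    intro o
    by_cases h : o = Quotient.mk (orbitRel L Ω) x
    · simp only [s, if_pos h]; exact h.symm
    · simp only [s, if_neg h]; exact Quotient.out_eq o
  let f : {c : Q // c ≠ 1} ⊕ orbitRel.Quotient L Ω → orbitRel.Quotient Lx Ω :=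
    Sum.elim (fun c => Quotient.mk _ ((r c.1 : G) • x)) (fun o => Quotient.mk _ (s o))
  have hLL : ∀ {u}, u ∈ Lx → u ∈ L := fun h => h.1
  have hf : Function.Injective f := by
    have h1 : ∀ (c : {c : Q // c ≠ 1}) (o : orbitRel.Quotient L Ω),
        f (Sum.inl c) ≠ f (Sum.inr o) := by
      intro c o h
      obtain ⟨u, hu, h⟩ := (mk_eq_iff_orb Lx _ _).1 h.symm
      have ho : o = Quotient.mk (orbitRel L Ω) x := by
        rw [← hs o, mk_eq_iff_orb]
        exact ⟨u * r c.1, L.mul_mem hu.1 (r c.1).2, by rw [mul_smul]; exact h⟩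
      have hsx : s o = x := by simp only [s, if_pos ho]
      rw [hsx] at h
      have hux : u • x = x := hu.2
      have h2 : (r c.1 : G) • x = x := by
        have := congrArg (fun y => u⁻¹ • y) h
        simp only [inv_smul_smul] at this
        rw [this, inv_smul_eq_iff]; exact hux.symm
      apply c.2
      rw [hr c.1, QuotientGroup.eq_one_iff]
      exact ⟨r c.1, ⟨(r c.1).2, h2⟩, rfl⟩
    rintro (c | o) (c' | o') h
    · congr 1
      obtain ⟨u, hu, h⟩ := (mk_eq_iff_orb Lx _ _).1 h
      apply Subtype.ext
      rw [hr c.1, hr c'.1, QuotientGroup.eq]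
      refine ⟨((r c.1 : G)⁻¹ * u * r c'.1)*u⁻¹, Lx.mul_mem ⟨?_, ?_⟩ (Lx.inv_mem hu), ?_⟩
      · exact L.mul_mem (L.mul_mem (L.inv_mem (r c.1).2) hu.1) (r c'.1).2
      · show _ • x = x
        rw [mul_smul, mul_smul, h, inv_smul_smul]
      · simp [mul_comm, mul_assoc]
    · exact (h1 _ _ h).elim
    · exact (h1 _ _ h.symm).elim
    · congr 1
      obtain ⟨u, hu, h⟩ := (mk_eq_iff_orb Lx _ _).1 h
      rw [← hs o, ← hs o', mk_eq_iff_orb]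
      exact ⟨u, hu.1, h⟩
  have hfinL : Finite (orbitRel.Quotient L Ω) := Quotient.finite _
  have hfinLx : Finite (orbitRel.Quotient Lx Ω) := Quotient.finite _
  have hc := Nat.card_le_card_of_injective f hf
  rw [Nat.card_sum] at hc
  have h2 : Nat.card {c : Q // c ≠ 1} + 1 = Nat.card Q := by
    have := Fintype.ofFinite Q
    rw [Nat.card_eq_fintype_card, Nat.card_eq_fintype_card, Fintype.card_subtype_compl]
    simp
    exact Nat.sub_add_cancel Fintype.card_pos
  rw [hm]
  unfold norb
  omega

lemma step_card {G A Ω : Type*} [Group G] [Finite G] [CommGroup A] [Finite Ω] [MulAction G Ω]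
    (φ : G →* A) (L : Subgroup G) (x : Ω) :
    Nat.card (L.map φ) * 2 ^ norb Ω L ≤
      Nat.card ((L ⊓ stabilizer G x).map φ) * 2 ^ norb Ω (L ⊓ stabilizer G x) := by
  have h := step_orb φ L x
  set m := ((L ⊓ stabilizer G x).map φ).relIndex (L.map φ)
  have h1 : Nat.card ((L ⊓ stabilizer G x).map φ) * m = Nat.card (L.map φ) := by
    have := Subgroup.relIndex_mul_relIndex ⊥ ((L ⊓ stabilizer G x).map φ) (L.map φ) bot_le
      (Subgroup.map_mono inf_le_left)
    simpa [Subgroup.relIndex_bot_left] using this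
  rw [← h1, mul_assoc]
  apply Nat.mul_le_mul_left
  have hm : m * 2 ≤ 2 ^ m := by
    rcases Nat.eq_zero_or_pos m with h0 | h0
    · simp [h0]
    · obtain ⟨j, hj⟩ := Nat.exists_eq_succ_of_ne_zero h0.ne'
      rw [hj, pow_succ]
      exact Nat.mul_le_mul_right _ Nat.lt_two_pow_self
  have : 2 ^ (norb Ω L + m) ≤ 2 ^ (norb Ω (L ⊓ stabilizer G x) + 1) :=
    Nat.pow_le_pow_right (by norm_num) h
  rw [pow_add, pow_succ] at this
  nlinarith [Nat.pos_of_ne_zero (pow_ne_zero (norb Ω L) (two_ne_zero (α := ℕ)))]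

lemma step_set {G A Ω : Type*} [Group G] [Finite G] [CommGroup A] [Finite Ω] [MulAction G Ω]
    (φ : G →* A) (L : Subgroup G) (S : Finset Ω) :
    Nat.card (L.map φ) * 2 ^ norb Ω L ≤
      Nat.card ((L ⊓ fixingSubgroup G (S : Set Ω)).map φ) *
        2 ^ norb Ω (L ⊓ fixingSubgroup G (S : Set Ω)) := by
  classical
  induction S using Finset.induction_on with
  | empty =>
    have : L ⊓ fixingSubgroup G ((∅ : Finset Ω) : Set Ω) = L := by
      apply inf_eq_left.2
      intro g _
      rw [mem_fixingSubgroup_iff]; simp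
    rw [this]
  | insert a S ha ih =>
    refine ih.trans ((step_card φ _ a).trans ?_)
    have : L ⊓ fixingSubgroup G (S : Set Ω) ⊓ stabilizer G a =
        L ⊓ fixingSubgroup G ((insert a S : Finset Ω) : Set Ω) := by
      ext g
      simp only [Subgroup.mem_inf, mem_fixingSubgroup_iff, mem_stabilizer_iff, Finset.coe_insert,
        Set.mem_insert_iff, forall_eq_or_imp]
      tauto
    rw [this]

lemma card_small {G A Ω : Type*} [Group G] [Finite G] [CommGroup A] [Finite Ω] [MulAction G Ω]
    [FaithfulSMul G Ω] (φ : G →* A) (U : Finset Ω) :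
    Nat.card ((fixingSubgroup G ((U : Set Ω)ᶜ)).map φ) ≤ 2 ^ U.card := by
  classical
  have := Fintype.ofFinite Ω
  set K := fixingSubgroup G ((U : Set Ω)ᶜ) with hK
  have h := step_set φ K (Finset.univ : Finset Ω)
  have h1 : K ⊓ fixingSubgroup G ((Finset.univ : Finset Ω) : Set Ω) = ⊥ := by
    rw [eq_bot_iff]
    intro g hg
    rw [Subgroup.mem_bot]
    apply FaithfulSMul.eq_of_smul_eq_smul (α := Ω)
    intro a
    have := (mem_fixingSubgroup_iff G).1 hg.2 a (by simp)
    rw [this, one_smul]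
  rw [h1, Subgroup.map_bot] at h
  have h2 : norb Ω (⊥ : Subgroup G) ≤ Fintype.card Ω := by
    rw [← Nat.card_eq_fintype_card]
    exact Nat.card_le_card_of_surjective (Quotient.mk _) Quotient.mk_surjective
  have h3 : Fintype.card Ω - U.card ≤ norb Ω K := by
    rw [← Finset.card_compl]
    have hfin : Finite (orbitRel.Quotient K Ω) := Quotient.finite _
    have := Nat.card_le_card_of_injective
      (fun x : {x // x ∈ Uᶜ} => (Quotient.mk (orbitRel K Ω) x.1)) (by
        intro x y hxy
        obtain ⟨u, hu, h⟩ := (mk_eq_iff_orb K _ _).1 hxy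
        have hy := (mem_fixingSubgroup_iff G).1 hu y.1 (by
          have := Finset.mem_compl.1 y.2
          simpa using this)
        rw [hy] at h
        exact Subtype.ext h.symm)
    rw [Nat.card_eq_fintype_card, Fintype.card_coe] at this
    exact this
  have hU := Finset.card_le_univ U
  have h4 : Nat.card ((⊥ : Subgroup A)) = 1 := by simp
  rw [h4, one_mul] at h
  have h5 : Nat.card (K.map φ) * 2 ^ (Fintype.card Ω - U.card) ≤ 2 ^ U.card * 2 ^ (Fintype.card Ω - U.card) := by
    rw [← pow_add, Nat.add_sub_cancel' hU]
    exact (Nat.mul_le_mul_left _ (Nat.pow_le_pow_right (by norm_num) h3)).trans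
      (h.trans (Nat.pow_le_pow_right (by norm_num) h2))
  exact Nat.le_of_mul_le_mul_right h5 (by positivity)

lemma perm_ai {Ω : Type*} (g : Equiv.Perm Ω) (x : Ω) : g (g⁻¹ x) = x := g.apply_symm_apply x

/-- the three-cycle a → b → c → a -/
def cyc {Ω : Type*} [DecidableEq Ω] (a b c : Ω) : Equiv.Perm Ω := Equiv.swap a b * Equiv.swap c b

lemma cyc_conj {Ω : Type*} [DecidableEq Ω] (g : Equiv.Perm Ω) (a b c : Ω) :
    g * cyc a b c * g⁻¹ = cyc (g a) (g b) (g c) := by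
  unfold cyc
  rw [Equiv.swap_apply_apply, Equiv.swap_apply_apply]
  group

lemma cyc_rot {Ω : Type*} [DecidableEq Ω] {a b c : Ω} (hab : a ≠ b) (hac : a ≠ c) :
    cyc a b c = cyc b c a := by
  have h := Equiv.swap_apply_apply (Equiv.swap b c) a c
  rw [Equiv.swap_apply_of_ne_of_ne hab hac, Equiv.swap_apply_right, Equiv.swap_inv] at h
  unfold cyc
  rw [h, Equiv.swap_comm c b, mul_assoc, Equiv.swap_mul_self, mul_one]

lemma cyc_inv {Ω : Type*} [DecidableEq Ω] (a b c : Ω) : (cyc a b c)⁻¹ = cyc c b a := by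
  unfold cyc; rw [mul_inv_rev, Equiv.swap_inv, Equiv.swap_inv]

lemma cyc_mul {Ω : Type*} [DecidableEq Ω] (a b c d : Ω) : cyc a b c * cyc c b d = cyc a b d := by
  unfold cyc
  rw [mul_assoc, ← mul_assoc (Equiv.swap c b), Equiv.swap_mul_self, one_mul]

lemma cyc_fix {Ω : Type*} [DecidableEq Ω] {a b c p : Ω} (h1 : p ≠ a) (h2 : p ≠ b) (h3 : p ≠ c) :
    cyc a b c p = p := by
  unfold cyc
  rw [Equiv.Perm.mul_apply, Equiv.swap_apply_of_ne_of_ne h3 h2, Equiv.swap_apply_of_ne_of_ne h1 h2]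

lemma cyc_fst {Ω : Type*} [DecidableEq Ω] {a b c : Ω} (h1 : a ≠ b) (h2 : a ≠ c) :
    cyc a b c a = b := by
  unfold cyc
  rw [Equiv.Perm.mul_apply, Equiv.swap_apply_of_ne_of_ne h2 h1, Equiv.swap_apply_left]

lemma cyc_trd {Ω : Type*} [DecidableEq Ω] {a b c : Ω} : cyc a b c c = a := by
  unfold cyc
  rw [Equiv.Perm.mul_apply, Equiv.swap_apply_left, Equiv.swap_apply_right]

/-- commutator of two three-cycles -/
lemma cyc_comm {Ω : Type*} [DecidableEq Ω] {x y z w b : Ω} (hxy : x ≠ y) (hxz : x ≠ z)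
    (hxw : x ≠ w) (hyz : y ≠ z) (hyw : y ≠ w) (hbx : b ≠ x) (hby : b ≠ y)
    (hbz : b ≠ z) (hbw : b ≠ w) :
    ⁅cyc y x b, cyc y z w⁆ = cyc y x z := by
  have h := cyc_conj (cyc y z w) y x b
  rw [cyc_fst hyz hyw, cyc_fix hxy hxz hxw, cyc_fix hby hbz hbw] at h
  have h2 : ⁅cyc y x b, cyc y z w⁆ = cyc y x b * (cyc y z w * cyc y x b * (cyc y z w)⁻¹)⁻¹ := by
    rw [commutatorElement_def]; group
  rw [h2, h, cyc_inv, cyc_mul]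

/-- elements of H fixing D pointwise -/
def InL {Ω : Type*} (H : Subgroup (Equiv.Perm Ω)) (D : Finset Ω) (g : Equiv.Perm Ω) : Prop :=
  g ∈ H ∧ ∀ p ∈ D, g p = p

lemma InL.mul {Ω : Type*} {H : Subgroup (Equiv.Perm Ω)} {D : Finset Ω} {g h : Equiv.Perm Ω}
    (hg : InL H D g) (hh : InL H D h) : InL H D (g * h) :=
  ⟨H.mul_mem hg.1 hh.1, fun p hp => by rw [Equiv.Perm.mul_apply, hh.2 p hp, hg.2 p hp]⟩

lemma InL.inv {Ω : Type*} {H : Subgroup (Equiv.Perm Ω)} {D : Finset Ω} {g : Equiv.Perm Ω}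
    (hg : InL H D g) : InL H D g⁻¹ :=
  ⟨H.inv_mem hg.1, fun p hp => by rw [Equiv.Perm.inv_eq_iff_eq, hg.2 p hp]⟩

lemma InL.notMem {Ω : Type*} {H : Subgroup (Equiv.Perm Ω)} {D : Finset Ω} {g : Equiv.Perm Ω}
    (hg : InL H D g) {x : Ω} (hx : x ∉ D) : g x ∉ D := by
  intro h
  have := hg.2 _ h
  exact hx (by rwa [g.injective this] at h)

/-- good pairs -/
def RR {Ω : Type*} [DecidableEq Ω] (H : Subgroup (Equiv.Perm Ω)) (D : Finset Ω) (b x : Ω) : Prop :=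
  b ∈ D ∧ x ∉ D ∧ (∃ g, InL H D g ∧ g x ≠ x) ∧
    ∀ g g', InL H D g → InL H D g' → g x ≠ g' x → cyc b (g x) (g' x) ∈ H

lemma RR_inv {Ω : Type*} [DecidableEq Ω] {H : Subgroup (Equiv.Perm Ω)} {D : Finset Ω} {b x : Ω}
    (h : RR H D b x) {u : Equiv.Perm Ω} (hu : InL H D u) : RR H D b (u x) := by
  obtain ⟨hb, hx, ⟨g, hg, hgx⟩, hc⟩ := h
  refine ⟨hb, hu.notMem hx, ⟨u * g * u⁻¹, (hu.mul hg).mul hu.inv, by simpa using hgx⟩, ?_⟩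
  intro g g' hg hg' hne
  exact hc (g * u) (g' * u) (hg.mul hu) (hg'.mul hu) hne

lemma RR_inj {Ω : Type*} [DecidableEq Ω] {H : Subgroup (Equiv.Perm Ω)} {D : Finset Ω} {b x y : Ω}
    (hx : RR H D b x) (hy : RR H D b y) : ∃ u, InL H D u ∧ u x = y := by
  by_contra hcon
  push Not at hcon
  obtain ⟨hb, hxD, ⟨g, hg, hgx⟩, hc⟩ := hx
  obtain ⟨-, hyD, ⟨g', hg', hgy⟩, hc'⟩ := hy
  have one : InL H D 1 := ⟨H.one_mem, fun _ _ => rfl⟩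
  have c1 := hc g 1 hg one hgx
  have c2 := hc' g' 1 hg' one hgy
  simp only [Equiv.Perm.coe_one, id] at c1 c2
  have hgxD := hg.notMem hxD
  have hgyD := hg'.notMem hyD
  have n1 : x ≠ y := fun h => hcon 1 one h
  have n2 : x ≠ g' y := fun h => hcon g'⁻¹ hg'.inv (by rw [h]; simp)
  have n3 : g x ≠ y := hcon g hg
  have n4 : g x ≠ g' y := fun h => hcon (g'⁻¹ * g) (hg'.inv.mul hg) (by simp [h])
  have hbx : b ≠ x := fun h => hxD (h ▸ hb)
  have hby : b ≠ y := fun h => hyD (h ▸ hb)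
  have hbgx : b ≠ g x := fun h => hgxD (h ▸ hb)
  have hbgy : b ≠ g' y := fun h => hgyD (h ▸ hb)
  have h := cyc_conj (cyc b (g' y) y) b (g x) x
  rw [cyc_fst hbgy hby, cyc_fix hbgx.symm n4 n3, cyc_fix hbx.symm n2 n1] at h
  have hm : cyc (g' y) (g x) x ∈ H := by
    rw [← h]; exact H.mul_mem (H.mul_mem c2 c1) (H.inv_mem c2)
  have hL : InL H D (cyc (g' y) (g x) x) := by
    refine ⟨hm, fun p hp => cyc_fix ?_ ?_ ?_⟩
    · rintro rfl; exact hgyD hp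
    · rintro rfl; exact hgxD hp
    · rintro rfl; exact hxD hp
  exact hcon (g'⁻¹ * cyc (g' y) (g x) x) (hg'.inv.mul hL) (by simp [cyc_trd])

lemma RR_exists {Ω : Type*} [DecidableEq Ω] {H : Subgroup (Equiv.Perm Ω)} {D : Finset Ω} {x : Ω}
    (hxD : x ∉ D) (hx : ∃ g, InL H D g ∧ g x ≠ x)
    (hh : ∃ h ∈ H, (∀ p ∉ insert x D, h p = p) ∧ h x ≠ x) : ∃ b, RR H D b x := by
  obtain ⟨h, hH, hfix, hhx⟩ := hh
  have hbx : h⁻¹ x ≠ x := fun h' => hhx (by rw [Equiv.Perm.inv_eq_iff_eq] at h'; exact h'.symm)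
  have hbD : h⁻¹ x ∈ D := by
    by_contra hb
    have := hfix (h⁻¹ x) (by rw [Finset.mem_insert]; exact not_or.2 ⟨hbx, hb⟩)
    rw [perm_ai] at this
    exact hbx this.symm
  have key : ∀ g, InL H D g → g x ≠ x → cyc (h⁻¹ x) (g x) x ∈ H := by
    intro g hg hgx
    have hgxD := hg.notMem hxD
    have hdis : Equiv.Perm.Disjoint (Equiv.swap x (g x) * g) h := by
      intro p
      by_cases hp : p ∈ insert x D
      · left
        rw [Finset.mem_insert] at hp
        rcases hp with rfl | hp
        · simp
        · rw [Equiv.Perm.mul_apply, hg.2 p hp, Equiv.swap_apply_of_ne_of_ne]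
          · rintro rfl; exact hxD hp
          · intro h; rw [h] at hp; exact hgxD hp
      · right; exact hfix p hp
    have hc := hdis.commute.eq
    have e1 : g * h * g⁻¹ = Equiv.swap x (g x) * h * Equiv.swap x (g x) := by
      have hss := Equiv.swap_mul_self x (g x)
      have : g * h = Equiv.swap x (g x) * h * Equiv.swap x (g x) * g := by
        calc g * h = (Equiv.swap x (g x) * Equiv.swap x (g x)) * g * h := by rw [hss, one_mul]
          _ = Equiv.swap x (g x) * (Equiv.swap x (g x) * g * h) := by simp only [mul_assoc]
          _ = _ := by rw [hc]; simp only [mul_assoc]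
      rw [this]; simp
    have e2 : h⁻¹ * (g * h * g⁻¹) = cyc (h⁻¹ x) (g x) x := by
      have hgg : h⁻¹ (g x) = g x := by
        rw [Equiv.Perm.inv_eq_iff_eq, hfix]
        simp [hgx, hgxD]
      rw [e1]
      have := Equiv.swap_apply_apply h⁻¹ x (g x)
      rw [hgg] at this
      unfold cyc
      rw [this]; simp [mul_assoc]
    rw [← e2]
    exact H.mul_mem (H.inv_mem hH) (H.mul_mem (H.mul_mem hg.1 hH) (H.inv_mem hg.1))
  refine ⟨h⁻¹ x, hbD, hxD, hx, fun g g' hg hg' hne => ?_⟩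
  have k := key (g'⁻¹ * g) (hg'.inv.mul hg) (fun h => hne (by
    rw [Equiv.Perm.mul_apply, Equiv.Perm.inv_eq_iff_eq] at h; exact h))
  have h2 := cyc_conj g' (h⁻¹ x) ((g'⁻¹ * g) x) x
  rw [hg'.2 _ hbD, Equiv.Perm.mul_apply, perm_ai] at h2
  rw [← h2]
  exact H.mul_mem (H.mul_mem hg'.1 k) (H.inv_mem hg'.1)

/-- three-cycles in the kernel -/
lemma cyc_ker {Ω A : Type*} [DecidableEq Ω] [CommGroup A] {H : Subgroup (Equiv.Perm Ω)}
    {D : Finset Ω} (φ : H →* A) {b x y z w : Ω}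
    (hx : RR H D b x) (hy : RR H D b y) (hz : RR H D b z) (hw : RR H D b w)
    (hxy : x ≠ y) (hxz : x ≠ z) (hxw : x ≠ w) (hyz : y ≠ z) (hyw : y ≠ w) (hzw : z ≠ w) :
    ∃ n : H, φ n = 1 ∧ (n : Equiv.Perm Ω) = cyc y x z := by
  have pair : ∀ {p q}, RR H D b p → RR H D b q → p ≠ q → cyc b p q ∈ H := by
    intro p q hp hq hpq
    obtain ⟨u, hu, rfl⟩ := RR_inj hp hq
    exact hp.2.2.2 1 u ⟨H.one_mem, fun _ _ => rfl⟩ hu hpq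
  have ne : ∀ {p}, RR H D b p → b ≠ p := by
    intro p hp h; exact hp.2.1 (h ▸ hp.1)
  have hA : cyc y x b ∈ H := by
    rw [← cyc_rot (ne hy) (ne hx)]; exact pair hy hx hxy.symm
  have hB : cyc y z w ∈ H := by
    have h1 : cyc y z b ∈ H := by
      rw [← cyc_rot (ne hy) (ne hz)]; exact pair hy hz hyz
    have h2 : cyc b w x ∈ H := pair hw hx hxw.symm
    have h := cyc_conj (cyc b w x) y z b
    rw [cyc_fst (ne hw) (ne hx), cyc_fix (ne hy).symm hyw hxy.symm,
      cyc_fix (ne hz).symm hzw hxz.symm] at h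
    rw [← h]
    exact H.mul_mem (H.mul_mem h2 h1) (H.inv_mem h2)
  refine ⟨⁅(⟨_, hA⟩ : H), ⟨_, hB⟩⁆, ?_, ?_⟩
  · rw [map_commutatorElement, commutatorElement_eq_one_iff_mul_comm, mul_comm]
  · exact cyc_comm hxy hxz hxw hyz hyw (ne hx) (ne hy) (ne hz) (ne hw)

lemma reduce {Ω A : Type*} [Fintype Ω] [DecidableEq Ω] [CommGroup A] {H : Subgroup (Equiv.Perm Ω)}
    {D U : Finset Ω} (φ : H →* A)
    (hU : ∀ x ∉ U, (∃ g, InL H D g ∧ g x ≠ x) → x ∉ D → ∃ b, RR H D b x ∧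
      ∃ V ⊆ U, V.card = 3 ∧ ∀ v ∈ V, RR H D b v) :
    ∀ (m : ℕ) (g : H), InL H D g →
      (Finset.univ.filter (fun p => p ∉ U ∧ (g : Equiv.Perm Ω) p ≠ p)).card = m →
      ∃ g' : H, φ g' = φ g ∧ ∀ p ∉ U, (g' : Equiv.Perm Ω) p = p := by
  intro m
  induction m using Nat.strong_induction_on with
  | _ m ih =>
    intro g hg hm
    by_cases hall : ∀ p ∉ U, (g : Equiv.Perm Ω) p = p
    · exact ⟨g, rfl, hall⟩
    push Not at hall
    obtain ⟨x, hxU, hgx⟩ := hall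
    have hxD : x ∉ D := fun h => hgx (hg.2 x h)
    obtain ⟨b, hb, V, hVU, hV3, hV⟩ := hU x hxU ⟨g, hg, hgx⟩ hxD
    set y := (g : Equiv.Perm Ω) x with hy
    have h2 : 1 < (V.erase y).card := by
      have := Finset.pred_card_le_card_erase (s := V) (a := y)
      omega
    obtain ⟨z, hz, w, hw, hzw⟩ := Finset.one_lt_card.1 h2
    rw [Finset.mem_erase] at hz hw
    have hxz : x ≠ z := by rintro rfl; exact hxU (hVU hz.2)
    have hxw : x ≠ w := by rintro rfl; exact hxU (hVU hw.2)
    have hyR : RR H D b y := RR_inv hb hg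
    obtain ⟨n, hn, hnc⟩ := cyc_ker φ hb hyR (hV z hz.2) (hV w hw.2) hgx.symm hxz hxw
      hz.1.symm hw.1.symm hzw
    have hnL : InL H D (n : Equiv.Perm Ω) := by
      refine ⟨n.2, fun p hp => ?_⟩
      rw [hnc]
      apply cyc_fix
      · rintro rfl; exact hyR.2.1 hp
      · rintro rfl; exact hxD hp
      · rintro rfl; exact (hV _ hz.2).2.1 hp
    have hlt : (Finset.univ.filter (fun p => p ∉ U ∧ ((n * g : H) : Equiv.Perm Ω) p ≠ p)).card < m := by
      rw [← hm]
      apply Finset.card_lt_card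
      rw [Finset.ssubset_iff_of_subset]
      · refine ⟨x, by simp [hxU, ← hy, hgx], ?_⟩
        simp only [Finset.mem_filter, Finset.mem_univ, true_and, not_and, not_not]
        intro _
        rw [Subgroup.coe_mul, Equiv.Perm.mul_apply, ← hy, hnc, cyc_fst hgx hz.1.symm]
      · intro p hp
        simp only [Finset.mem_filter, Finset.mem_univ, true_and] at hp ⊢
        refine ⟨hp.1, fun hgp => hp.2 ?_⟩
        rw [Subgroup.coe_mul, Equiv.Perm.mul_apply, hgp, hnc]
        apply cyc_fix
        · intro hpy
          rw [hpy] at hgp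
          have hgp' : (g : Equiv.Perm Ω) y = (g : Equiv.Perm Ω) x := hgp
          exact hgx ((g : Equiv.Perm Ω).injective hgp')
        · rintro rfl; exact hgx hgp
        · rintro rfl; exact hp.1 (hVU hz.2)
    obtain ⟨g', h1, h2⟩ := ih _ hlt (n * g) (hnL.mul hg) rfl
    exact ⟨g', by rw [h1, map_mul, hn, one_mul], h2⟩

/-- no nontrivial element of H is supported in S -/
def FreeSet {Ω : Type*} (H : Subgroup (Equiv.Perm Ω)) (S : Finset Ω) : Prop :=
  ∀ h ∈ H, (∀ p ∉ S, h p = p) → h = 1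

lemma free_index {Ω : Type*} [Fintype Ω] [DecidableEq Ω] {H : Subgroup (Equiv.Perm Ω)}
    {S : Finset Ω} (hS : FreeSet H S) : S.card.factorial ≤ H.index := by
  have hc : Nat.card (Equiv.Perm {x // x ∈ S}) = S.card.factorial := by
    rw [Nat.card_eq_fintype_card, Fintype.card_perm, Fintype.card_coe]
  rw [← hc]
  refine Nat.card_le_card_of_injective
    (fun f : Equiv.Perm {x // x ∈ S} => (QuotientGroup.mk (Equiv.Perm.ofSubtype f) : Equiv.Perm Ω ⧸ H)) ?_
  intro f f' h
  have h' := QuotientGroup.eq.1 h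
  rw [← map_inv, ← map_mul] at h'
  have := hS _ h' (fun p hp => Equiv.Perm.ofSubtype_apply_of_not_mem _ hp)
  rw [← map_one (Equiv.Perm.ofSubtype (p := fun x => x ∈ S))] at this
  have := Equiv.Perm.ofSubtype_injective this
  exact inv_mul_eq_one.1 this

lemma main_fin {Ω : Type*} [Fintype Ω] [DecidableEq Ω] (H : Subgroup (Equiv.Perm Ω)) :
    ∃ s : ℕ, s.factorial ≤ H.index ∧ Nat.card (Abelianization H) ≤ 2 ^ (6 * s) := by
  classical
  obtain ⟨D, hD, hmax⟩ := Finset.exists_max_image (Finset.univ.filter (FreeSet H)) Finset.card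
    ⟨∅, by
      simp only [Finset.mem_filter, Finset.mem_univ, true_and]
      intro h _ hf
      ext p; simpa using hf p⟩
  simp only [Finset.mem_filter, Finset.mem_univ, true_and] at hD hmax
  refine ⟨D.card, free_index hD, ?_⟩
  have hex : ∀ x ∉ D, ∃ h ∈ H, (∀ p ∉ insert x D, h p = p) ∧ h x ≠ x := by
    intro x hx
    by_contra hcon
    push Not at hcon
    have : FreeSet H (insert x D) := by
      intro h hH hf
      refine hD h hH (fun p hp => ?_)
      by_cases hpx : p = x
      · rw [hpx]; exact hcon h hH hf
      · exact hf p (by simp [hpx, hp])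
    have := hmax _ this
    rw [Finset.card_insert_of_notMem hx] at this
    omega
  let F : Finset Ω := Finset.univ.filter (fun x => x ∉ D ∧ ∀ g, InL H D g → g x = x)
  have hF : F.card ≤ D.card := by
    apply hmax
    intro h hH hf
    have hL : InL H D h := ⟨hH, fun p hp => hf p (by simp [F, hp])⟩
    ext p
    by_cases hp : p ∈ F
    · simp only [F, Finset.mem_filter, Finset.mem_univ, true_and] at hp
      simpa using hp.2 h hL
    · simpa using hf p hp
  let φ : H →* Abelianization H := Abelianization.of
  let L : Subgroup H := fixingSubgroup H (D : Set Ω)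
  have hLmem : ∀ g : H, g ∈ L ↔ InL H D g := by
    intro g
    rw [mem_fixingSubgroup_iff]
    exact ⟨fun h => ⟨g.2, h⟩, fun h => h.2⟩
  -- orbits
  have horb : norb Ω L ≤ 3 * D.card := by
    have hcode : ∀ x : Ω, ∃ c : D ⊕ (D ⊕ F), (∀ p, c = Sum.inl p → x = p) ∧
        (∀ p, c = Sum.inr (Sum.inl p) → RR H D p x) ∧ (∀ p, c = Sum.inr (Sum.inr p) → x = p) := by
      intro x
      by_cases hxD : x ∈ D
      · exact ⟨Sum.inl ⟨x, hxD⟩, by rintro p h; cases h; rfl, by simp, by simp⟩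
      by_cases hxF : ∀ g, InL H D g → g x = x
      · exact ⟨Sum.inr (Sum.inr ⟨x, by simp [F, hxD]; exact hxF⟩), by simp, by simp,
          by rintro p h; cases h; rfl⟩
      · push Not at hxF
        obtain ⟨b, hb⟩ := RR_exists hxD hxF (hex x hxD)
        exact ⟨Sum.inr (Sum.inl ⟨b, hb.1⟩), by simp, by rintro p h; cases h; exact hb, by simp⟩
    choose c hc1 hc2 hc3 using hcode
    have hinj : Function.Injective (fun o : orbitRel.Quotient L Ω => c (Quotient.out o)) := by
      intro o o' h
      simp only at h
      rw [← Quotient.out_eq o, ← Quotient.out_eq o']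
      rcases hco : c (Quotient.out o) with p | p | p
      · rw [hc1 _ p hco, hc1 _ p (h.symm.trans hco)]
      · obtain ⟨u, hu, hux⟩ := RR_inj (hc2 _ p (h ▸ hco)) (hc2 _ p hco)
        exact (mk_eq_iff_orb L _ _).2 ⟨⟨u, hu.1⟩, (hLmem _).2 hu, hux⟩
      · rw [hc3 _ p hco, hc3 _ p (h.symm.trans hco)]
    have := Nat.card_le_card_of_injective _ hinj
    rw [Nat.card_sum, Nat.card_sum] at this
    simp only [Nat.card_eq_fintype_card (α := D), Nat.card_eq_fintype_card (α := F),
      Fintype.card_coe] at this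
    unfold norb
    omega
  -- the set U
  have hV : ∀ b : Ω, ∃ V : Finset Ω, (∀ v ∈ V, RR H D b v) ∧ V.card ≤ 3 ∧
      (V.card = 3 ∨ ∀ x, RR H D b x → x ∈ V) := by
    intro b
    rcases le_or_gt 3 (Finset.univ.filter (RR H D b)).card with h | h
    · obtain ⟨V, hV, hc⟩ := Finset.exists_subset_card_eq h
      exact ⟨V, fun v hv => (Finset.mem_filter.1 (hV hv)).2, hc.le, Or.inl hc⟩
    · exact ⟨_, fun v hv => (Finset.mem_filter.1 hv).2, h.le, Or.inr (fun x hx => by simp [hx])⟩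
  choose V hV1 hV2 hV3 using hV
  let U := D.biUnion V
  have hUc : U.card ≤ D.card * 3 := Finset.card_biUnion_le_card_mul _ _ _ (fun b _ => hV2 b)
  have hred := reduce (D := D) (U := U) φ (by
    intro x hxU hx hxD
    obtain ⟨b, hb⟩ := RR_exists hxD hx (hex x hxD)
    refine ⟨b, hb, V b, Finset.subset_biUnion_of_mem V hb.1, ?_, hV1 b⟩
    rcases hV3 b with h | h
    · exact h
    · exact (hxU (Finset.subset_biUnion_of_mem V hb.1 (h x hb))).elim)
  have hmap : L.map φ ≤ (fixingSubgroup H ((U : Set Ω)ᶜ)).map φ := by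
    rintro _ ⟨g, hg, rfl⟩
    obtain ⟨g', h1, h2⟩ := hred _ g ((hLmem g).1 hg) rfl
    refine ⟨g', ?_, h1⟩
    apply (mem_fixingSubgroup_iff H).2
    intro p hp
    exact h2 p (by simpa using hp)
  have hA : Finite (Abelianization H) := Finite.of_surjective φ (QuotientGroup.mk_surjective)
  have hcL : Nat.card (L.map φ) ≤ 2 ^ (3 * D.card) :=
    (Subgroup.card_le_of_le hmap).trans ((card_small φ U).trans
      (Nat.pow_le_pow_right (by norm_num) (by omega)))
  have hs := step_set φ (⊤ : Subgroup H) D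
  rw [top_inf_eq] at hs
  have htop : Nat.card ((⊤ : Subgroup H).map φ) = Nat.card (Abelianization H) := by
    rw [Subgroup.map_top_of_surjective φ (QuotientGroup.mk_surjective)]
    exact Subgroup.card_top
  rw [htop] at hs
  calc Nat.card (Abelianization H) ≤ Nat.card (Abelianization H) * 2 ^ norb Ω (⊤ : Subgroup H) :=
        Nat.le_mul_of_pos_right _ (by positivity)
    _ ≤ _ := hs
    _ ≤ 2 ^ (3 * D.card) * 2 ^ (3 * D.card) :=
        Nat.mul_le_mul hcL (Nat.pow_le_pow_right (by norm_num) horb)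
    _ = 2 ^ (6 * D.card) := by rw [← pow_add]; congr 1; ring


lemma final_real (s n : ℕ) (hn : 3 ≤ n) (hs : s.factorial ≤ n) (q : ℕ) (hq : q ≤ 2 ^ (6 * s)) :
    (q : ℝ) ≤ 2 ^ (48 * Real.logb 2 n / Real.logb 2 (Real.logb 2 n)) := by
  set t := Real.logb 2 (n : ℝ) with ht
  have hn' : (3 : ℝ) ≤ n := by exact_mod_cast hn
  have hl2 : 0 < Real.log 2 := Real.log_pos (by norm_num)
  have hl2' : Real.log 2 < 1 := by linarith [Real.log_two_lt_d9]
  have hl2'' : 0.5 < Real.log 2 := by linarith [Real.log_two_gt_d9]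
  have ht1 : 1 < t := by
    rw [ht, Real.lt_logb_iff_rpow_lt (by norm_num) (by linarith)]
    norm_num; linarith
  have hlt : 0 < Real.logb 2 t := Real.logb_pos (by norm_num) ht1
  have hL : Real.logb 2 t = Real.log t / Real.log 2 := rfl
  have hltn : 0 < Real.log t := Real.log_pos ht1
  have htn : t * Real.log 2 = Real.log n := by
    rw [ht, Real.logb]; field_simp
  have key : (s : ℝ) * Real.logb 2 t ≤ 8 * t := by
    rcases le_or_gt s 7 with h8 | h8
    · have h8' : (s : ℝ) ≤ 7 := by exact_mod_cast h8
      have h1 : Real.logb 2 t ≤ 8/7 * t := by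
        rw [hL, div_le_iff₀ hl2]
        -- log t ≤ t/e
        have h3 : Real.log (t / 2) ≤ t / 2 - 1 := Real.log_le_sub_one_of_pos (by linarith)
        rw [Real.log_div (by linarith) (by norm_num)] at h3
        nlinarith
      nlinarith
    · have h8' : (8 : ℝ) ≤ s := by exact_mod_cast h8
      rcases le_or_gt ((s : ℝ) ^ 2) t with hst | hst
      · have hq1 : (s : ℝ) ≤ Real.sqrt t := Real.le_sqrt_of_sq_le hst
        have hsq : 0 < Real.sqrt t := Real.sqrt_pos.2 (by linarith)
        have h3 : Real.log (Real.sqrt t) ≤ Real.sqrt t - 1 := Real.log_le_sub_one_of_pos hsq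
        rw [Real.log_sqrt (by linarith)] at h3
        have h4 : Real.logb 2 t ≤ 4 * Real.sqrt t := by
          rw [hL, div_le_iff₀ hl2]; nlinarith
        have h5 : Real.sqrt t * Real.sqrt t = t := Real.mul_self_sqrt (by linarith)
        nlinarith
      · have hspos : (0 : ℝ) < s := by linarith
        have h1 : Real.log t ≤ 2 * Real.log s := by
          have := Real.log_le_log (by linarith) hst.le
          rwa [Real.log_pow] at this
        have h2 : (2 : ℝ) ≤ Real.log s := by
          have : Real.log 8 ≤ Real.log s := Real.log_le_log (by norm_num) h8'
          have h8e : Real.log 8 = 3 * Real.log 2 := by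
            rw [show (8 : ℝ) = 2 ^ 3 by norm_num, Real.log_pow]; norm_num
          linarith [Real.log_two_gt_d9]
        have h3 := Real.pow_div_factorial_le_exp (x := (s : ℝ)) hspos.le s
        have hf : (0 : ℝ) < s.factorial := by exact_mod_cast s.factorial_pos
        have h4 := Real.log_le_log (by positivity) h3
        rw [Real.log_exp, Real.log_div (by positivity) hf.ne', Real.log_pow] at h4
        have h5 : Real.log s.factorial ≤ Real.log n :=
          Real.log_le_log hf (by exact_mod_cast hs)
        rw [hL, mul_div_assoc', div_le_iff₀ hl2]
        nlinarith
  have h1 : (q : ℝ) ≤ 2 ^ ((6 * s : ℕ) : ℝ) := by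
    rw [Real.rpow_natCast]; exact_mod_cast hq
  refine h1.trans (Real.rpow_le_rpow_of_exponent_le (by norm_num) ?_)
  rw [le_div_iff₀ hlt]
  push_cast
  linarith

/-- There exists an absolute constant `α > 0` such that for every `k ≥ 1` and every
subgroup `H` of `G = Sym(k)` of index at least `3`, one has
`|H/H'| ≤ 2 ^ (α · log₂ |G:H| / log₂ log₂ |G:H|)`. -/
theorem abelian_sections_of_symmetric_group :
    ∃ α : ℝ, 0 < α ∧ ∀ (k : ℕ), 1 ≤ k → ∀ H : Subgroup (Equiv.Perm (Fin k)),
      3 ≤ H.index →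
      (Nat.card (Abelianization H) : ℝ) ≤
        2 ^ (α * Real.logb 2 (H.index) / Real.logb 2 (Real.logb 2 (H.index))) := by
  refine ⟨48, by norm_num, fun k _ H hH => ?_⟩
  obtain ⟨s, hs, hq⟩ := main_fin H
  exact final_real s H.index hH hs _ hq
end

section
/- There exist an absolute constant α > 0 and a constant K such that for every k ≥ K and every subgroup H of G = Sym(k) that acts transitively on the k points and has index |G : H| ≥ 3, one has log|H/H'| ≤ α · log|G:H| / log log |G:H|. -/
open Equiv in
def aux_restr {G α : Type*} [Group G] (φ : G →* Perm α) (p : α → Prop)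
    (h : ∀ g x, p (φ g x) ↔ p x) : G →* Perm {x // p x} where
  toFun g := (φ g).subtypePerm (h g)
  map_one' := by ext x; simp
  map_mul' a b := by simp only [map_mul]; rfl

theorem aux_index_eq {G T : Type*} [Group G] [Group T] (φ : G →* T)
    (hφ : Function.Surjective φ) :
    (commutator G).index = (commutator G).relIndex φ.ker * (commutator T).index := by
  have h1 : commutator T = (commutator G).map φ := by
    rw [commutator_def, commutator_def, Subgroup.map_commutator, ← MonoidHom.range_eq_map,
      MonoidHom.range_eq_top.2 hφ]
  rw [← Subgroup.index_comap_of_surjective (commutator T) hφ, h1, Subgroup.comap_map_eq,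
    ← Subgroup.relIndex_mul_index (le_sup_left : commutator G ≤ commutator G ⊔ φ.ker),
    Subgroup.relIndex_sup_left]

theorem aux_relIndex_le {G : Type*} [Group G] [Finite G] (K : Subgroup G) :
    (commutator G).relIndex K ≤ (commutator K).index := by
  have : commutator K ≤ (commutator G).subgroupOf K := by
    show _ ≤ (commutator G).comap K.subtype
    rw [← Subgroup.map_le_iff_le_comap, commutator_def, Subgroup.map_commutator]
    exact Subgroup.commutator_mono le_top le_top
  exact Subgroup.index_antitone this

theorem aux_index_le {G T : Type*} [Group G] [Finite G] [Group T] (φ : G →* T) :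
    (commutator G).index ≤ (commutator φ.ker).index * (commutator φ.range).index := by
  rw [aux_index_eq φ.rangeRestrict φ.rangeRestrict_surjective, MonoidHom.ker_rangeRestrict]
  exact Nat.mul_le_mul_right _ (aux_relIndex_le _)

open Equiv in
def AuxBound (n : ℕ) : Prop :=
  ∀ (α β G : Type) [Fintype α] [Fintype β] [Group G] [Finite G] (φ : G →* Perm α)
    (f : α → β), Function.Injective φ → Function.Surjective f →
    (∀ g x, f (φ g x) = f x) → Fintype.card α = n →
    (commutator G).index * 2 ^ Fintype.card β ≤ 2 ^ n

open Equiv in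
theorem aux_case1 (n : ℕ) (ih : ∀ m < n, AuxBound m)
  (α β G : Type) [Fintype α] [Fintype β] [Group G] [Finite G] (φ : G →* Perm α)
    (f : α → β) (hφ : Function.Injective φ) (hf : Function.Surjective f)
    (hi : ∀ g x, f (φ g x) = f x) (hn : Fintype.card α = n) (hβ : 2 ≤ Fintype.card β) :
    (commutator G).index * 2 ^ Fintype.card β ≤ 2 ^ n := by
  classical
  obtain ⟨b, c, hbc⟩ := Fintype.exists_pair_of_one_lt_card (by omega : 1 < Fintype.card β)
  obtain ⟨xb, hxb⟩ := hf b
  obtain ⟨xc, hxc⟩ := hf c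
  let ρ := aux_restr φ (fun x => f x = b) (fun g x => by simp only [hi])
  let σ := aux_restr φ (fun x => ¬ f x = b) (fun g x => by simp only [hi])
  have hcard : Fintype.card {x // f x = b} + Fintype.card {x // ¬ f x = b} = n := by
    rw [← hn]
    have := Fintype.card_subtype_compl (fun x => f x = b)
    have := Fintype.card_subtype_le (fun x => f x = b)
    omega
  have p1 : 0 < Fintype.card {x // f x = b} := Fintype.card_pos_iff.2 ⟨⟨xb, hxb⟩⟩
  have p2 : 0 < Fintype.card {x // ¬ f x = b} :=
    Fintype.card_pos_iff.2 ⟨⟨xc, by rw [hxc]; exact hbc.symm⟩⟩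
  have e1 := ih _ (by omega) {x // f x = b} Unit ρ.range ρ.range.subtype (fun _ => ())
    (Subgroup.subtype_injective _) (fun _ => ⟨⟨xb, hxb⟩, rfl⟩) (fun _ _ => rfl) rfl
  have hinj : Function.Injective (σ.comp ρ.ker.subtype) := by
    rw [injective_iff_map_eq_one]
    rintro ⟨g, hg⟩ h
    have hg' : ρ g = 1 := hg
    have h' : σ g = 1 := h
    apply Subtype.ext
    apply hφ
    show φ g = φ 1
    rw [map_one]
    ext x
    by_cases hx : f x = b
    · exact congrArg Subtype.val (Equiv.congr_fun hg' ⟨x, hx⟩)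
    · exact congrArg Subtype.val (Equiv.congr_fun h' ⟨x, hx⟩)
  have e2 := ih _ (by omega) {x // ¬ f x = b} {y // ¬ y = b} ρ.ker (σ.comp ρ.ker.subtype)
    (fun x => ⟨f x.1, x.2⟩) hinj
    (by rintro ⟨y, hy⟩; obtain ⟨x, rfl⟩ := hf y; exact ⟨⟨x, hy⟩, rfl⟩)
    (by rintro g ⟨x, hx⟩; exact Subtype.ext (hi _ _)) rfl
  have hcb : Fintype.card {y // ¬ y = b} + 1 = Fintype.card β := by
    have := Fintype.card_subtype_compl (fun x => x = b)
    simp only [Fintype.card_subtype_eq] at this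
    omega
  have e3 := aux_index_le ρ
  rw [← hcb, ← hcard, pow_add, pow_add]
  simp only [Fintype.card_unit] at e1
  calc _ ≤ ((commutator ρ.ker).index * (commutator ρ.range).index) * (2 ^ Fintype.card {y // ¬ y = b} * 2 ^ 1) :=
        Nat.mul_le_mul_right _ e3
    _ = ((commutator ρ.range).index * 2 ^ 1) * ((commutator ρ.ker).index * 2 ^ Fintype.card {y // ¬ y = b}) := by ring
    _ ≤ _ := Nat.mul_le_mul e1 e2

open Equiv in
def auxK {G α : Type*} [Group G] (φ : G →* Perm α) (N : Subgroup G) : Subgroup G where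
  carrier := {g | ∀ x, ∃ c ∈ N, φ c x = φ g x}
  mul_mem' := by
    intro a b ha hb x
    obtain ⟨c, hc, h1⟩ := hb x
    obtain ⟨d, hd, h2⟩ := ha (φ b x)
    exact ⟨d * c, N.mul_mem hd hc, by simp [h1, h2]⟩
  one_mem' := fun x => ⟨1, N.one_mem, rfl⟩
  inv_mem' := by
    intro a ha x
    obtain ⟨c, hc, h1⟩ := ha (φ a⁻¹ x)
    refine ⟨c⁻¹, N.inv_mem hc, ?_⟩
    rw [map_inv, Perm.inv_eq_iff_eq, h1, map_inv]; simp

open Equiv in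
def auxS {G α : Type*} [Group G] (φ : G →* Perm α) (N : Subgroup G) : Setoid α where
  r x y := ∃ c ∈ N, φ c x = y
  iseqv := by
    refine ⟨fun x => ⟨1, N.one_mem, by simp⟩, ?_, ?_⟩
    · rintro x y ⟨c, hc, rfl⟩
      exact ⟨c⁻¹, N.inv_mem hc, by simp⟩
    · rintro x y z ⟨c, hc, rfl⟩ ⟨d, hd, rfl⟩
      exact ⟨d * c, N.mul_mem hd hc, by simp⟩

open Equiv in
theorem aux_bound (n : ℕ) : AuxBound n := by
  classical
  induction n using Nat.strong_induction_on with
  | _ n ih =>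
  intro α β G _ _ _ _ φ f hφ hf hi hn
  by_cases hβ : 2 ≤ Fintype.card β
  · exact aux_case1 n ih α β G φ f hφ hf hi hn hβ
  by_cases hα : IsEmpty α
  · have : Subsingleton G := hφ.subsingleton
    have hb : IsEmpty β := ⟨fun b => hα.elim (hf b).choose⟩
    rw [Fintype.card_eq_zero, Subgroup.index_eq_one.2 (Subsingleton.elim _ _)]
    simpa using Nat.one_le_two_pow
  rw [not_isEmpty_iff] at hα
  obtain ⟨x0⟩ := hα
  have hβ1 : Fintype.card β = 1 := by
    have : 0 < Fintype.card β := Fintype.card_pos_iff.2 ⟨f x0⟩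
    omega
  rw [hβ1, pow_one]
  have hpos : 0 < n := hn ▸ Fintype.card_pos_iff.2 ⟨x0⟩
  by_cases ht : ∀ y, ∃ g, φ g x0 = y
  swap
  · let Q := Quotient (auxS φ ⊤)
    push Not at ht
    obtain ⟨y, hy⟩ := ht
    have hne : (Quotient.mk (auxS φ ⊤) x0) ≠ Quotient.mk (auxS φ ⊤) y := by
      intro h
      obtain ⟨c, _, hc⟩ := Quotient.exact h
      exact hy c hc
    have h2 : 2 ≤ Fintype.card Q := Fintype.one_lt_card_iff.2 ⟨_, _, hne⟩
    have := aux_case1 n ih α Q G φ (Quotient.mk _) hφ Quotient.mk_surjective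
      (fun g x => (Quotient.sound ⟨g, trivial, rfl⟩ : Quotient.mk (auxS φ ⊤) x = _).symm) hn h2
    refine le_trans (Nat.mul_le_mul_left _ ?_) this
    calc 2 = 2 ^ 1 := rfl
      _ ≤ _ := Nat.pow_le_pow_right (by norm_num) (by omega)
  by_cases ht' : ∀ y, ∃ g ∈ commutator G, φ g x0 = y
  · let S : Subgroup G := (MulAction.stabilizer (Perm α) x0).comap φ
    have hS : ∀ g, g ∈ S ↔ φ g x0 = x0 := fun g => Iff.rfl
    have htop : commutator G ⊔ S = ⊤ := by
      rw [eq_top_iff]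
      intro g _
      obtain ⟨c, hc, h⟩ := ht' (φ g x0)
      have : c⁻¹ * g ∈ S := by rw [hS]; simp [← h]
      have h2 := Subgroup.mul_mem_sup hc this
      simpa using h2
    have e1 : (commutator G).index ≤ (commutator S).index := by
      rw [← Subgroup.relIndex_top_right, ← htop, Subgroup.relIndex_sup_left]
      exact aux_relIndex_le S
    by_cases hsub : n = 1
    · have : Subsingleton α := Fintype.card_le_one_iff_subsingleton.1 (by omega)
      have : Subsingleton G := hφ.subsingleton
      rw [Subgroup.index_eq_one.2 (Subsingleton.elim _ _), hsub]
      norm_num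
    have hc : Fintype.card {y // y ≠ x0} = n - 1 := by
      rw [Fintype.card_subtype_compl, hn, Fintype.card_subtype_eq]
    have hst : ∀ (g : S) y, (φ.comp S.subtype) g y ≠ x0 ↔ y ≠ x0 := by
      intro g y
      have : φ g x0 = x0 := (hS _).1 g.2
      have h2 : φ g y = x0 ↔ y = x0 := by
        conv_lhs => rw [← this]
        exact (φ g).injective.eq_iff
      exact not_congr h2
    have : Nonempty {y // y ≠ x0} := Fintype.card_pos_iff.1 (by omega)
    have e2 := ih (n-1) (by omega) {y // y ≠ x0} Unit S (aux_restr (φ.comp S.subtype) _ hst)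
      (fun _ => ()) (by
        rw [injective_iff_map_eq_one]
        rintro ⟨g, hg⟩ h
        apply Subtype.ext
        apply hφ
        show φ g = φ 1
        rw [map_one]
        ext x
        by_cases hx : x = x0
        · rw [hx]; exact hg
        · exact congrArg Subtype.val (Equiv.congr_fun h ⟨x, hx⟩)) (fun _ => ⟨this.some, rfl⟩)
        (fun _ _ => rfl) hc
    simp only [Fintype.card_unit, pow_one] at e2
    calc _ ≤ (commutator S).index * 2 := Nat.mul_le_mul_right _ e1
      _ ≤ _ := e2
      _ ≤ _ := Nat.pow_le_pow_right (by norm_num) (by omega)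
  · push Not at ht'
    obtain ⟨y, hy⟩ := ht'
    let s := auxS φ (commutator G)
    let K := auxK φ (commutator G)
    have hne : (Quotient.mk s x0) ≠ Quotient.mk s y := by
      intro h
      obtain ⟨c, h1, hc⟩ := Quotient.exact h
      exact hy c h1 hc
    have h2 : 2 ≤ Fintype.card (Quotient s) := Fintype.one_lt_card_iff.2 ⟨_, _, hne⟩
    have e1 := aux_case1 n ih α (Quotient s) K (φ.comp K.subtype) (Quotient.mk _)
      (hφ.comp (Subgroup.subtype_injective _)) Quotient.mk_surjective
      (fun g x => (Quotient.sound (g.2 x) : Quotient.mk s x = _).symm) hn h2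
    have hle : commutator G ≤ K := fun g hg x => ⟨g, hg, rfl⟩
    have hK : ∀ w, (∃ c ∈ commutator G, φ c x0 = φ w x0) → w ∈ K := by
      rintro w ⟨c, hc, h⟩ x
      obtain ⟨u, rfl⟩ := ht x
      refine ⟨(w * u * w⁻¹ * u⁻¹) * (u * c * u⁻¹), Subgroup.mul_mem _ ?_ ?_, ?_⟩
      · exact Subgroup.commutator_mem_commutator trivial trivial
      · exact (inferInstance : (commutator G).Normal).conj_mem c hc u
      · have : (w * u * w⁻¹ * u⁻¹) * (u * c * u⁻¹) * u = w * u * w⁻¹ * c := by group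
        rw [← Perm.mul_apply, ← map_mul, this, map_mul, Perm.mul_apply, h]
        simp
    have e2 : K.index ≤ Fintype.card (Quotient s) := by
      rw [← Nat.card_eq_fintype_card]
      refine Nat.card_le_card_of_injective (fun c : G ⧸ K => Quotient.mk s (φ c.out x0)) ?_
      intro c d h
      obtain ⟨e, he, h⟩ := Quotient.exact h
      rw [← QuotientGroup.out_eq' c, ← QuotientGroup.out_eq' d, QuotientGroup.eq]
      apply hK
      refine ⟨c.out⁻¹ * e * c.out, ?_, ?_⟩
      · simpa using (inferInstance : (commutator G).Normal).conj_mem e he c.out⁻¹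
      · simp only [map_mul, Perm.mul_apply, h]
    have e3 := Subgroup.relIndex_mul_index hle
    have e4 := aux_relIndex_le K
    have e5 : Fintype.card (Quotient s) * 2 ≤ 2 ^ Fintype.card (Quotient s) := by
      generalize Fintype.card (Quotient s) = q at h2
      induction q, h2 using Nat.le_induction with
      | base => norm_num
      | succ q hq ih => rw [pow_succ]; omega
    rw [← e3]
    calc _ ≤ (commutator K).index * Fintype.card (Quotient s) * 2 :=
          Nat.mul_le_mul_right _ (Nat.mul_le_mul e4 e2)
      _ = (commutator K).index * (Fintype.card (Quotient s) * 2) := by ring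
      _ ≤ _ := Nat.mul_le_mul_left _ e5
      _ ≤ _ := e1

open Equiv in
theorem aux_bound' {α G : Type} [Fintype α] [Group G] [Finite G] (φ : G →* Perm α)
    (hφ : Function.Injective φ) : (commutator G).index ≤ 2 ^ Fintype.card α := by
  classical
  have := aux_bound (Fintype.card α) α (Quotient (auxS φ ⊤)) G φ (Quotient.mk _) hφ
    Quotient.mk_surjective
    (fun g x => (Quotient.sound ⟨g, trivial, rfl⟩ : Quotient.mk (auxS φ ⊤) x = _).symm) rfl
  exact le_trans (Nat.le_mul_of_pos_right _ (by positivity)) this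

open Equiv in
def aux_t {α : Type*} [DecidableEq α] (x y z : α) : Perm α := swap x y * swap y z

open Equiv in
theorem aux_comm {α : Type*} [DecidableEq α] (g h : Perm α) (d : α)
    (hgh : ∀ x, x = d ∨ g x = x ∨ h x = x) (hg : g d ≠ d) (hh : h d ≠ d) :
    g * h * g⁻¹ * h⁻¹ = aux_t d (g d) (h d) := by
  have e1 : h (g d) = g d := by
    have h1 := hgh (g d)
    have : g (g d) ≠ g d := fun h => hg (g.injective h)
    tauto
  have e2 : g (h d) = h d := by
    have h1 := hgh (h d)
    have : h (h d) ≠ h d := fun h' => hh (h.injective h')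
    tauto
  have hne : g d ≠ h d := by
    intro h'
    rw [h'] at e1
    exact hh (h.injective e1)
  rw [mul_inv_eq_iff_eq_mul, mul_inv_eq_iff_eq_mul]
  ext x
  simp only [aux_t, Perm.mul_apply]
  by_cases hx : x = d
  · subst hx
    rw [e1, e2, swap_apply_left, swap_apply_of_ne_of_ne hh hne.symm]
  have hgx : g x ≠ g d := fun h' => hx (g.injective h')
  have hhx : h x ≠ h d := fun h' => hx (h.injective h')
  rcases hgh x with h1 | h1 | h1
  · exact absurd h1 hx
  · rw [h1]
    rw [h1] at hgx
    by_cases h2 : h x = d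
    · rw [h2, swap_apply_of_ne_of_ne hg.symm hh.symm, swap_apply_left]
    · have h3 : h x ≠ g d := by
        intro h3
        rw [← e1] at h3
        exact hgx (h.injective h3)
      rw [swap_apply_of_ne_of_ne h3 hhx, swap_apply_of_ne_of_ne h2 h3]
      by_cases h4 : h x = x
      · rw [h4, h1]
      · have : h (h x) ≠ h x := fun h' => h4 (h.injective h')
        have := hgh (h x)
        tauto
  · rw [h1]
    rw [h1] at hhx
    by_cases h2 : g x = d
    · rw [h2, swap_apply_right, swap_apply_right]
    · have h4 : h (g x) = g x := by
        by_cases h4 : g x = x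
        · rw [h4, h1]
        · have : g (g x) ≠ g x := fun h' => h4 (g.injective h')
          have := hgh (g x)
          tauto
      have h5 : g x ≠ h d := by
        intro h5
        rw [h5] at h4
        exact hh (h.injective h4)
      rw [h4, swap_apply_of_ne_of_ne hgx h5, swap_apply_of_ne_of_ne h2 hgx]

open Equiv in
theorem aux_t_apply {α : Type*} [DecidableEq α] {x y z : α} (hxy : x ≠ y) (hyz : y ≠ z)
    (hxz : x ≠ z) (w : α) :
    aux_t x y z w = if w = x then y else if w = y then z else if w = z then x else w := by
  simp only [aux_t, Perm.mul_apply, swap_apply_def]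
  grind

open Equiv in
theorem aux_t_conj {α : Type*} [DecidableEq α] (g : Perm α) (x y z : α) :
    g * aux_t x y z * g⁻¹ = aux_t (g x) (g y) (g z) := by
  simp only [aux_t, swap_apply_apply]
  group

open Equiv in
theorem aux_t_inv {α : Type*} [DecidableEq α] (x y z : α) :
    (aux_t x y z)⁻¹ = aux_t z y x := by
  simp only [aux_t, mul_inv_rev, swap_inv, swap_comm]

open Equiv in
theorem aux_t_rot {α : Type*} [DecidableEq α] {x y z : α} (hxy : x ≠ y) (hyz : y ≠ z)
    (hxz : x ≠ z) : aux_t x y z = aux_t y z x := by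
  ext w
  rw [aux_t_apply hxy hyz hxz, aux_t_apply hyz hxz.symm hxy.symm]
  grind

open Equiv in
theorem aux_caseA {α : Type*} [Fintype α] [DecidableEq α] (H : Subgroup (Perm α))
    (hH : ∀ x y z : α, x ≠ y → y ≠ z → x ≠ z → aux_t x y z ∉ H) :
    (Fintype.card α - Fintype.card α / 2).factorial ≤ H.index := by
  classical
  let P : Finset α → Prop := fun D => ∀ g ∈ H, (∀ x ∈ D, g x = x) → g = 1
  obtain ⟨D, hD, hmin⟩ := Finset.exists_min_image (Finset.univ.filter P) Finset.card
    ⟨Finset.univ, by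
      simp only [Finset.mem_filter, Finset.mem_univ, true_and]
      intro g _ h
      ext x
      exact h x (Finset.mem_univ _)⟩
  simp only [Finset.mem_filter, Finset.mem_univ, true_and] at hD hmin
  have hcard : D.card ≤ Fintype.card α / 2 := by
    by_contra hlt
    have h1 : ¬ P Dᶜ := by
      intro h
      have := hmin _ h
      rw [Finset.card_compl] at this
      omega
    simp only [P, not_forall] at h1
    obtain ⟨h, hh, hfix, hne⟩ := h1
    obtain ⟨d, hd⟩ : ∃ d, h d ≠ d := by
      by_contra! hc
      exact hne (Equiv.ext hc)
    have hdD : d ∈ D := by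
      by_contra hc
      exact hd (hfix d (by simpa using hc))
    have h2 : ¬ P (D.erase d) := by
      intro h
      have := hmin _ h
      rw [Finset.card_erase_of_mem hdD] at this
      have : 0 < D.card := Finset.card_pos.2 ⟨d, hdD⟩
      omega
    simp only [P, not_forall] at h2
    obtain ⟨g, hg, hgfix, hgne⟩ := h2
    have hgd : g d ≠ d := by
      intro hc
      apply hgne
      apply hD g hg
      intro x hx
      by_cases hxd : x = d
      · rw [hxd, hc]
      · exact hgfix x (Finset.mem_erase.2 ⟨hxd, hx⟩)
    have hcomm := aux_comm g h d (fun x => by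
      by_cases hxd : x = d
      · exact Or.inl hxd
      by_cases hx : x ∈ D
      · exact Or.inr (Or.inl (hgfix x (Finset.mem_erase.2 ⟨hxd, hx⟩)))
      · exact Or.inr (Or.inr (hfix x (by simpa using hx)))) hgd hd
    refine hH d (g d) (h d) hgd.symm ?_ hd.symm ?_
    · intro hc
      have h3 : h d ∈ D := by
        by_contra h3
        have := hfix (h d) (by simpa using h3)
        exact hd (h.injective this)
      have := hgfix (h d) (Finset.mem_erase.2 ⟨hd, h3⟩)
      rw [← hc] at this
      exact hgd (g.injective this)
    · rw [← hcomm]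
      exact H.mul_mem (H.mul_mem (H.mul_mem hg hh) (H.inv_mem hg)) (H.inv_mem hh)
  have hle : Nat.card H ≤ (Fintype.card α).descFactorial D.card := by
    have : Fintype.card (D ↪ α) = (Fintype.card α).descFactorial D.card := by
      rw [Fintype.card_embedding_eq, Fintype.card_coe]
    rw [← this, ← Nat.card_eq_fintype_card]
    refine Nat.card_le_card_of_injective
      (fun h : H => (⟨fun x => h.1 x.1, fun x y hxy => Subtype.ext (h.1.injective hxy)⟩ : D ↪ α)) ?_
    intro g h hgh
    have : ∀ x ∈ D, g.1 x = h.1 x := fun x hx =>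
      congrArg (fun e : D ↪ α => e ⟨x, hx⟩) hgh
    have := hD (h.1⁻¹ * g.1) (H.mul_mem (H.inv_mem h.2) g.2) (fun x hx => by
      rw [Perm.mul_apply, this x hx]; simp)
    apply Subtype.ext
    rw [inv_mul_eq_one] at this
    exact this.symm
  have h1 := H.card_mul_index
  rw [Nat.card_eq_fintype_card (α := Perm α), Fintype.card_perm,
    ← Nat.factorial_mul_descFactorial (le_trans hcard (Nat.div_le_self _ 2))] at h1
  have hpos : 0 < (Fintype.card α).descFactorial D.card :=
    Nat.descFactorial_pos.2 (le_trans hcard (Nat.div_le_self _ 2))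
  have h2 : (Fintype.card α - D.card).factorial * (Fintype.card α).descFactorial D.card ≤
      H.index * (Fintype.card α).descFactorial D.card := by
    rw [← h1, mul_comm]
    exact Nat.mul_le_mul_left _ hle
  have h3 := Nat.le_of_mul_le_mul_right h2 hpos
  exact le_trans (Nat.factorial_le (by omega)) h3

section auxB
open Equiv

theorem aux_tri {α : Type*} [DecidableEq α] (H : Subgroup (Perm α)) {x y z u v : α}
    (hxy : x ≠ y) (hyz : y ≠ z) (hxz : x ≠ z) (hux : u ≠ x) (huy : u ≠ y)
    (hvy : v ≠ y) (hvz : v ≠ z) (h1 : aux_t x y u ∈ H) (h2 : aux_t y z v ∈ H) :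
    aux_t x y z ∈ H := by
  have conj : ∀ g ∈ H, ∀ a b c, aux_t a b c ∈ H → aux_t (g a) (g b) (g c) ∈ H := by
    intro g hg a b c h
    rw [← aux_t_conj]
    exact H.mul_mem (H.mul_mem hg h) (H.inv_mem hg)
  have inv : ∀ a b c, aux_t a b c ∈ H → aux_t c b a ∈ H := by
    intro a b c h
    rw [← aux_t_inv]
    exact H.inv_mem h
  by_cases e1 : u = z
  · rwa [← e1]
  by_cases e2 : v = x
  · rw [e2] at h2
    rw [aux_t_rot hxy hyz hxz]
    exact h2
  by_cases e3 : u = v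
  · subst e3
    have := conj _ h2 _ _ _ h1
    simp only [aux_t_apply hyz hvz.symm hvy.symm] at this
    simp [hxy, hxz, hux.symm, huy, e1] at this
    have h3 := inv _ _ _ this
    rw [aux_t_rot hyz hxz.symm hxy.symm, aux_t_rot hxz.symm hxy hyz.symm] at h3
    exact h3
  · have h3 := conj _ h2 _ _ _ h1
    simp only [aux_t_apply hyz hvz.symm hvy.symm] at h3
    simp [hxy, hxz, huy, e1, e3, Ne.symm e2] at h3
    have h4 := conj _ h3 _ _ _ h1
    simp only [aux_t_apply hxz (Ne.symm e1) hux.symm] at h4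
    simp [hxy.symm, hyz, hux, huy.symm, e1] at h4
    exact inv _ _ _ h4

/-- the 3-cycle relation -/
def auxR {α : Type*} [DecidableEq α] (H : Subgroup (Perm α)) (x y : α) : Prop :=
  x = y ∨ ∃ z, x ≠ y ∧ z ≠ x ∧ z ≠ y ∧ aux_t x y z ∈ H

theorem auxR_tri {α : Type*} [DecidableEq α] (H : Subgroup (Perm α)) {x y z : α}
    (hxy : x ≠ y) (hyz : y ≠ z) (hxz : x ≠ z) (h1 : auxR H x y) (h2 : auxR H y z) :
    aux_t x y z ∈ H := by
  rcases h1 with h1 | ⟨u, -, hu1, hu2, hu⟩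
  · exact absurd h1 hxy
  rcases h2 with h2 | ⟨v, -, hv1, hv2, hv⟩
  · exact absurd h2 hyz
  exact aux_tri H hxy hyz hxz hu1 hu2 hv1 hv2 hu hv

def auxRS {α : Type*} [DecidableEq α] (H : Subgroup (Perm α)) : Setoid α where
  r := auxR H
  iseqv := by
    refine ⟨fun x => Or.inl rfl, ?_, ?_⟩
    · rintro x y (h | ⟨z, h0, h1, h2, h3⟩)
      · exact Or.inl h.symm
      · refine Or.inr ⟨z, h0.symm, h2, h1, ?_⟩
        have := H.inv_mem h3
        rw [aux_t_inv, aux_t_rot h2 h0.symm h1] at this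
        exact this
    · intro x y z h1 h2
      by_cases hxy : x = y
      · rwa [hxy]
      by_cases hyz : y = z
      · rwa [← hyz]
      by_cases hxz : x = z
      · exact Or.inl hxz
      refine Or.inr ⟨y, hxz, Ne.symm hxy, hyz, ?_⟩
      have := H.inv_mem (auxR_tri H hxy hyz hxz h1 h2)
      rw [aux_t_inv, aux_t_rot (Ne.symm hyz) (Ne.symm hxy) (Ne.symm hxz),
        aux_t_rot (Ne.symm hxy) hxz hyz] at this
      exact this

theorem auxR_map {α : Type*} [DecidableEq α] (H : Subgroup (Perm α)) {g : Perm α} (hg : g ∈ H)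
    {x y : α} (h : auxR H x y) : auxR H (g x) (g y) := by
  rcases h with h | ⟨z, h0, h1, h2, h3⟩
  · exact Or.inl (by rw [h])
  · refine Or.inr ⟨g z, by simpa, by simpa, by simpa, ?_⟩
    rw [← aux_t_conj]
    exact H.mul_mem (H.mul_mem hg h3) (H.inv_mem hg)

def auxTau {α : Type*} [DecidableEq α] (H : Subgroup (Perm α)) :
    H →* Perm (Quotient (auxRS H)) where
  toFun g :=
    { toFun := Quotient.map g.1 (fun _ _ h => auxR_map H g.2 h)
      invFun := Quotient.map (g.1⁻¹ : Perm α) (fun _ _ h => auxR_map H (H.inv_mem g.2) h)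
      left_inv := by rintro ⟨x⟩; exact congrArg (Quotient.mk _) (by simp)
      right_inv := by rintro ⟨x⟩; exact congrArg (Quotient.mk _) (by simp) }
  map_one' := by ext ⟨x⟩; rfl
  map_mul' a b := by ext ⟨x⟩; rfl

theorem auxTau_mk {α : Type*} [DecidableEq α] (H : Subgroup (Perm α)) (g : H) (x : α) :
    auxTau H g (Quotient.mk _ x) = Quotient.mk _ (g.1 x) := rfl

theorem auxTau_ker {α : Type*} [DecidableEq α] (H : Subgroup (Perm α)) (g : (auxTau H).ker) (x : α) :
    Quotient.mk (auxRS H) (g.1.1 x) = Quotient.mk (auxRS H) x := by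
  rw [← auxTau_mk, (g.2 : auxTau H g.1 = 1)]; rfl

def auxE {α ι : Type*} (f : α → ι) : (∀ i, Perm {a // f a = i}) →* Perm α where
  toFun g := DomMulAct.stabilizerEquiv_invFun_aux g
  map_one' := by ext x; rfl
  map_mul' a b := by
    ext x
    exact (DomMulAct.stabilizerEquiv_invFun_eq a
      (DomMulAct.comp_stabilizerEquiv_invFun b x)).symm

theorem auxE_single {α ι : Type*} [DecidableEq ι] (f : α → ι) (i : ι)
    (σ : Perm {a // f a = i}) : auxE f (Pi.mulSingle i σ) = Perm.ofSubtype σ := by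
  ext x
  by_cases hx : f x = i
  · rw [Perm.ofSubtype_apply_of_mem σ hx]
    subst hx
    show ((Pi.mulSingle (f x) σ : ∀ i, Perm {a // f a = i}) (f x) ⟨x, rfl⟩ : α) = _
    rw [Pi.mulSingle_eq_same]
  · rw [Perm.ofSubtype_apply_of_not_mem σ hx]
    show ((Pi.mulSingle i σ : ∀ i, Perm {a // f a = i}) (f x) ⟨x, rfl⟩ : α) = _
    rw [Pi.mulSingle_eq_of_ne hx]; rfl

theorem aux_alt_le {α : Type*} [Fintype α] [DecidableEq α] (M : Subgroup (Perm α))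
    (p : α → Prop) [DecidablePred p]
    (hM : ∀ x y z, p x → p y → p z → x ≠ y → y ≠ z → x ≠ z → aux_t x y z ∈ M) :
    alternatingGroup {x // p x} ≤ M.comap Perm.ofSubtype := by
  rw [← Perm.closure_three_cycles_eq_alternating, Subgroup.closure_le]
  intro σ hσ
  have hσ : σ.IsThreeCycle := hσ
  obtain ⟨a, ha⟩ := hσ.isCycle.nonempty_support
  have h1 := hσ.eq_swap_mul_swap_iff_mem_support.2 ha
  have h2 := hσ.nodup_iff_mem_support.2 ha
  simp at h2
  show Perm.ofSubtype σ ∈ M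
  rw [h1, map_mul, Perm.ofSubtype_swap_eq, Perm.ofSubtype_swap_eq]
  refine hM _ _ _ a.2 (σ a).2 (σ (σ a)).2 ?_ ?_ ?_
  · exact fun h => h2.1.1 (Subtype.ext h)
  · exact fun h => h2.1.1 (σ.injective (Subtype.ext h))
  · exact fun h => h2.1.2 (Subtype.ext h)

theorem aux_mem_M {α ι : Type*} [Fintype α] [DecidableEq α] [Finite ι] [DecidableEq ι]
    (f : α → ι) (M : Subgroup (Perm α))
    (hM : ∀ x y z, f x = f y → f y = f z → x ≠ y → y ≠ z → x ≠ z → aux_t x y z ∈ M)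
    (g : Perm α) (hg : ∀ x, f (g x) = f x)
    (hs : ∀ i, Perm.sign (g.subtypePerm (p := fun x => f x = i) (fun x => by rw [hg])) = 1) :
    g ∈ M := by
  have h1 : (fun i => g.subtypePerm (p := fun x => f x = i) (fun x => by rw [hg])) ∈
      M.comap (auxE f) := by
    apply Subgroup.pi_mem_of_mulSingle_mem
    intro i
    rw [Subgroup.mem_comap, auxE_single]
    refine aux_alt_le M (fun x => f x = i) ?_ (Perm.mem_alternatingGroup.2 (hs i))
    intro x y z hx hy hz
    exact hM x y z (hx.trans hy.symm) (hy.trans hz.symm)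
  have h2 : auxE f (fun i => g.subtypePerm (p := fun x => f x = i) (fun x => by rw [hg])) = g := by
    ext x; rfl
  rw [Subgroup.mem_comap, h2] at h1
  exact h1

theorem aux_caseB {α : Type} [Fintype α] [DecidableEq α] (H : Subgroup (Perm α))
    (ht : ∀ x y : α, ∃ g ∈ H, g x = y) {x0 y0 z0 : α} (hxy : x0 ≠ y0) (hyz : y0 ≠ z0)
    (hxz : x0 ≠ z0) (h0 : aux_t x0 y0 z0 ∈ H) (hind : 3 ≤ H.index) :
    ∃ a b : ℕ, 3 ≤ a ∧ 2 ≤ b ∧ a * b = Fintype.card α ∧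
      (commutator H).index ≤ 16 ^ b ∧ Nat.card H ≤ a.factorial ^ b * b.factorial := by
  classical
  let ι := Quotient (auxRS H)
  let f : α → ι := Quotient.mk (auxRS H)
  have hfe : ∀ {x y}, f x = f y → auxR H x y := fun h => Quotient.exact h
  have hfs : ∀ {x y}, auxR H x y → f x = f y := fun h => Quotient.sound h
  let a := Fintype.card {x // f x = f x0}
  have hfib : ∀ i, Fintype.card {x // f x = i} = a := by
    intro i
    show Fintype.card _ = Fintype.card _
    rw [← Nat.card_eq_fintype_card, ← Nat.card_eq_fintype_card]
    obtain ⟨y, rfl⟩ := Quotient.exists_rep i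
    obtain ⟨g, hg, rfl⟩ := ht x0 y
    refine Nat.card_congr (Equiv.symm (Equiv.subtypeEquiv g ?_))
    intro x
    constructor
    · intro h
      exact hfs (auxR_map H hg (hfe h))
    · intro h
      have h := auxR_map H (H.inv_mem hg) (hfe h)
      simp at h
      exact hfs h
  have hab : a * Fintype.card ι = Fintype.card α := by
    rw [Fintype.card_congr (Equiv.sigmaFiberEquiv f).symm, Fintype.card_sigma]
    simp [hfib, mul_comm]
  have hr1 : auxR H x0 y0 := Or.inr ⟨z0, hxy, hxz.symm, hyz.symm, h0⟩
  have hr2 : auxR H z0 x0 := by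
    refine Or.inr ⟨y0, hxz.symm, hyz, hxy.symm, ?_⟩
    rw [aux_t_rot hxz.symm hxy hyz.symm]; exact h0
  have ha3 : 3 ≤ a := by
    have : ({⟨x0, rfl⟩, ⟨y0, (hfs hr1).symm⟩, ⟨z0, hfs hr2⟩} :
        Finset {x // f x = f x0}).card = 3 := by
      rw [Finset.card_eq_three]
      exact ⟨_, _, _, by simpa using hxy, by simpa using hxz, by simpa using hyz, rfl⟩
    rw [← this]
    exact Finset.card_le_univ _
  have hmemH : ∀ x y z, f x = f y → f y = f z → x ≠ y → y ≠ z → x ≠ z → aux_t x y z ∈ H :=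
    fun x y z h1 h2 a b c => auxR_tri H a b c (hfe h1) (hfe h2)
  have hb2 : 2 ≤ Fintype.card ι := by
    by_contra hlt
    have hss : Subsingleton ι := Fintype.card_le_one_iff_subsingleton.1 (by omega)
    have : Nontrivial α := ⟨x0, y0, hxy⟩
    have hle : alternatingGroup α ≤ H := by
      intro g hg
      refine aux_mem_M (fun _ => ()) H ?_ g (fun _ => rfl) ?_
      · intro x y z _ _
        exact hmemH x y z (Subsingleton.elim _ _) (Subsingleton.elim _ _)
      · intro i
        rw [Perm.sign_subtypePerm _ _ (fun _ _ => rfl)]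
        exact hg
    have := Subgroup.index_antitone hle
    rw [alternatingGroup.index_eq_two] at this
    omega
  refine ⟨a, Fintype.card ι, ha3, hb2, hab, ?_, ?_⟩
  · by_cases ha5 : 5 ≤ a
    swap
    · have h1 := aux_bound' H.subtype H.subtype_injective
      refine h1.trans ?_
      rw [← hab, show 16 = 2 ^ 4 from rfl, ← pow_mul]
      exact Nat.pow_le_pow_right (by norm_num) (Nat.mul_le_mul_right _ (by omega))
    rw [aux_index_eq (auxTau H).rangeRestrict (auxTau H).rangeRestrict_surjective,
      MonoidHom.ker_rangeRestrict]
    have e1 : (commutator (auxTau H).range).index ≤ 2 ^ Fintype.card ι :=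
      aux_bound' (auxTau H).range.subtype (Subgroup.subtype_injective _)
    let ψ : (auxTau H).ker →* (ι → ℤˣ) :=
      { toFun := fun g i => Perm.sign (g.1.1.subtypePerm (p := fun x => f x = i)
          (fun x => by rw [show f (g.1.1 x) = f x from auxTau_ker H g x]))
        map_one' := by funext i; exact Perm.sign_one
        map_mul' := by
          intro g h
          funext i
          rw [Pi.mul_apply, ← Perm.sign_mul]
          rfl }
    have e2 : (commutator H).relIndex (auxTau H).ker ≤ 2 ^ Fintype.card ι := by
      have hk : ψ.ker ≤ (commutator H).subgroupOf (auxTau H).ker := by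
        intro g hg
        have hg' : ψ g = 1 := hg
        have : g.1.1 ∈ (commutator H).map H.subtype := by
          refine aux_mem_M f _ ?_ g.1.1 (auxTau_ker H g) (fun i => congrFun hg' i)
          intro x y z hxy' hyz' nxy nyz nxz
          obtain ⟨p, hp, np⟩ : ∃ p, f p = f x ∧ p ∉ ({x, y, z} : Finset α) := by
            by_contra! hc
            have : Fintype.card {w // f w = f x} ≤ ({x, y, z} : Finset α).card := by
              rw [Fintype.card_subtype]
              exact Finset.card_le_card (fun w hw => hc w (by simpa using hw))
            rw [hfib] at this
            have := Finset.card_le_three (a := x) (b := y) (c := z)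
            omega
          obtain ⟨q, hq, nq⟩ : ∃ q, f q = f x ∧ q ∉ ({x, y, z, p} : Finset α) := by
            by_contra! hc
            have : Fintype.card {w // f w = f x} ≤ ({x, y, z, p} : Finset α).card := by
              rw [Fintype.card_subtype]
              exact Finset.card_le_card (fun w hw => hc w (by simpa using hw))
            rw [hfib] at this
            have := Finset.card_le_four (a := x) (b := y) (c := z) (d := p)
            omega
          simp only [Finset.mem_insert, Finset.mem_singleton, not_or] at np nq
          obtain ⟨np1, np2, np3⟩ := np
          obtain ⟨nq1, nq2, nq3, nq4⟩ := nq
          have g1 : aux_t x y p ∈ H := hmemH x y p hxy' (hxy'.symm.trans hp.symm) nxy (Ne.symm np2)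
            (Ne.symm np1)
          have g2 : aux_t x z q ∈ H := hmemH x z q (hxy'.trans hyz')
            ((hxy'.trans hyz').symm.trans hq.symm) nxz (Ne.symm nq3) (Ne.symm nq1)
          have v1 : aux_t x y p x = y := by
            rw [aux_t_apply nxy (Ne.symm np2) (Ne.symm np1)]; simp
          have v2 : aux_t x z q x = z := by
            rw [aux_t_apply nxz (Ne.symm nq3) (Ne.symm nq1)]; simp
          have hc := aux_comm (aux_t x y p) (aux_t x z q) x (by
            intro w
            rw [aux_t_apply nxy (Ne.symm np2) (Ne.symm np1),
              aux_t_apply nxz (Ne.symm nq3) (Ne.symm nq1)]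
            grind) (by rw [v1]; exact nxy.symm) (by rw [v2]; exact nxz.symm)
          rw [v1, v2] at hc
          rw [← hc]
          exact ⟨(⟨_, g1⟩ : H) * (⟨_, g2⟩ : H) * (⟨_, g1⟩ : H)⁻¹ * (⟨_, g2⟩ : H)⁻¹,
            Subgroup.commutator_mem_commutator trivial trivial, rfl⟩
        obtain ⟨c, hc, hcg⟩ := this
        have : c = g.1 := Subtype.ext hcg
        rw [Subgroup.mem_subgroupOf, ← this]
        exact hc
      have h1 := Subgroup.index_antitone hk
      refine le_trans h1 ?_
      rw [Subgroup.index_ker]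
      have : Nat.card (ι → ℤˣ) = 2 ^ Fintype.card ι := by
        rw [Nat.card_eq_fintype_card, Fintype.card_fun, Fintype.card_units_int]
      rw [← this]
      exact Subgroup.card_le_card_group _
    refine (Nat.mul_le_mul e2 e1).trans ?_
    rw [← mul_pow]
    exact Nat.pow_le_pow_left (by norm_num) _
  · rw [← Subgroup.card_mul_index (auxTau H).ker, Subgroup.index_ker]
    refine Nat.mul_le_mul ?_ ?_
    · have h1 := DomMulAct.stabilizer_card f
      simp only [hfib, Finset.prod_const, Finset.card_univ] at h1
      rw [← h1, ← Nat.card_eq_fintype_card]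
      refine Nat.card_le_card_of_injective
        (fun g : (auxTau H).ker => (⟨g.1.1, funext (auxTau_ker H g)⟩ : {g : Perm α // f ∘ g = f})) ?_
      intro g h hgh
      exact Subtype.ext (Subtype.ext (congrArg (fun q : {g : Perm α // f ∘ g = f} => q.1) hgh))
    · rw [← Fintype.card_perm, ← Nat.card_eq_fintype_card]
      exact Subgroup.card_le_card_group _
end auxB

theorem aux_asc (a b : ℕ) : ∀ j ≤ a, (b + 1) ^ j * j.factorial ≤ (a * b + 1).ascFactorial j := by
  intro j
  induction j with
  | zero => intro _; simp
  | succ j ih =>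
    intro hj
    rw [Nat.ascFactorial_succ, pow_succ, Nat.factorial_succ]
    have h1 : (b + 1) * (j + 1) ≤ a * b + 1 + j := by
      have := Nat.mul_le_mul_right b hj
      nlinarith
    calc _ = ((b + 1) * (j + 1)) * ((b + 1) ^ j * j.factorial) := by ring
      _ ≤ _ := Nat.mul_le_mul h1 (ih (by omega))

theorem aux_fact (a b : ℕ) :
    b.factorial ^ a * a.factorial ^ b ≤ (a * b).factorial := by
  induction b with
  | zero => simp
  | succ b ih =>
    rw [mul_add, mul_one, ← Nat.factorial_mul_ascFactorial (a * b) a, Nat.factorial_succ, mul_pow, pow_succ]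
    calc _ = (b.factorial ^ a * a.factorial ^ b) * ((b + 1) ^ a * a.factorial) := by ring
      _ ≤ _ := Nat.mul_le_mul ih (aux_asc a b a le_rfl)

theorem aux_fact_sq (b : ℕ) : b ^ b ≤ b.factorial ^ 2 := by
  have h1 := Finset.prod_range_add_one_eq_factorial b
  have h2 := Finset.prod_range_reflect (fun i => i + 1) b
  rw [h1] at h2
  have h3 : b.factorial ^ 2 = ∏ j ∈ Finset.range b, ((j + 1) * (b - 1 - j + 1)) := by
    rw [Finset.prod_mul_distrib, h1, h2, sq]
  rw [h3]
  calc b ^ b = ∏ j ∈ Finset.range b, b := by simp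
    _ ≤ _ := by
      apply Finset.prod_le_prod'
      intro j hj
      have hj := Finset.mem_range.1 hj
      obtain ⟨c, rfl⟩ : ∃ c, b = j + 1 + c := ⟨b - (j + 1), by omega⟩
      have : j + 1 + c - 1 - j = c := by omega
      rw [this]
      nlinarith

theorem aux_log_fact (b : ℕ) (hb : 1 ≤ b) :
    (b : ℝ) / 2 * Real.logb 2 b ≤ Real.logb 2 b.factorial := by
  have h : ((b : ℝ)) ^ b ≤ (b.factorial : ℝ) ^ 2 := by exact_mod_cast aux_fact_sq b
  have hb' : (0 : ℝ) < b := by exact_mod_cast hb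
  have h2 := Real.logb_le_logb_of_le (b := 2) (by norm_num) (by positivity) h
  rw [Real.logb_pow, Real.logb_pow] at h2
  push_cast at h2
  linarith

theorem aux_log_le (a : ℕ) (ha : 1 ≤ a) : Real.logb 2 a ≤ a := by
  have ha' : (0 : ℝ) < a := by exact_mod_cast ha
  rw [Real.logb_le_iff_le_rpow (by norm_num) ha', Real.rpow_natCast]
  exact_mod_cast Nat.lt_two_pow_self.le

theorem aux_log_cast_le (m n : ℕ) (hm : 1 ≤ m) (h : m ≤ n) :
    Real.logb 2 m ≤ Real.logb 2 n := by
  apply Real.logb_le_logb_of_le (by norm_num)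
  · exact_mod_cast hm
  · exact_mod_cast h

theorem aux_final (k N : ℕ) (y : ℝ) (hk : 4 ≤ k) (hN : 3 ≤ N) (hNk : N ≤ k.factorial)
    (hy : 0 ≤ y) (h : y * (2 * Real.logb 2 k) ≤ 64 * Real.logb 2 N) :
    y ≤ 64 * Real.logb 2 N / Real.logb 2 (Real.logb 2 N) := by
  have hN' : (3 : ℝ) ≤ N := by exact_mod_cast hN
  have h1 : 1 < Real.logb 2 N := by
    rw [Real.lt_logb_iff_rpow_lt (by norm_num) (by linarith)]
    norm_num; linarith
  have h2 : 0 < Real.logb 2 (Real.logb 2 N) := Real.logb_pos (by norm_num) h1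
  rw [le_div_iff₀ h2]
  refine le_trans (mul_le_mul_of_nonneg_left ?_ hy) h
  have hk0 : (0 : ℝ) < k := by exact_mod_cast (by omega : 0 < k)
  have h3 : Real.logb 2 N ≤ (k : ℝ) ^ 2 := by
    have : Real.logb 2 N ≤ Real.logb 2 ((k ^ k : ℕ)) :=
      aux_log_cast_le _ _ (by omega) (hNk.trans (Nat.factorial_le_pow k))
    push_cast at this
    rw [Real.logb_pow] at this
    have h4 := aux_log_le k (by omega)
    nlinarith
  have h5 := Real.logb_le_logb_of_le (b := 2) (by norm_num) (by linarith) h3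
  rw [Real.logb_pow] at h5
  exact_mod_cast h5

/-- There exist an absolute constant `α > 0` and a constant `K` such that for every
`k ≥ K` and every transitive subgroup `H` of `G = Sym(k)` of index at least `3`, one has
`log₂ |H/H'| ≤ α · log₂ |G:H| / log₂ log₂ |G:H|`. -/
theorem abelianization_of_transitive_subgroups :
    ∃ α : ℝ, 0 < α ∧ ∃ K : ℕ, ∀ (k : ℕ), K ≤ k → ∀ H : Subgroup (Equiv.Perm (Fin k)),
      MulAction.IsPretransitive H (Fin k) →
      3 ≤ H.index →
      Real.logb 2 (Nat.card (Abelianization H)) ≤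
        α * Real.logb 2 (H.index) / Real.logb 2 (Real.logb 2 (H.index)) := by
  refine ⟨64, by norm_num, 4, ?_⟩
  intro k hk H htr hind
  have hcard : Nat.card (Abelianization H) = (commutator H).index := rfl
  rw [hcard]
  have hpos : 1 ≤ (commutator H).index := Nat.one_le_iff_ne_zero.2 Subgroup.index_ne_zero_of_finite
  have hmul := H.card_mul_index
  rw [Nat.card_eq_fintype_card (α := Equiv.Perm (Fin k)), Fintype.card_perm, Fintype.card_fin] at hmul
  have hy : 0 ≤ Real.logb 2 (commutator H).index :=
    Real.logb_nonneg (by norm_num) (by exact_mod_cast hpos)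
  have hNk : H.index ≤ k.factorial :=
    Nat.le_of_dvd (Nat.factorial_pos k) (Dvd.intro_left _ hmul)
  apply aux_final k _ _ hk hind hNk hy
  have hk4 : (4 : ℝ) ≤ k := by exact_mod_cast hk
  have hLk : 0 ≤ Real.logb 2 k := Real.logb_nonneg (by norm_num) (by linarith)
  by_cases hA : ∀ x y z : Fin k, x ≠ y → y ≠ z → x ≠ z → aux_t x y z ∉ H
  · have h1 := aux_caseA H hA
    have h2 := aux_bound' H.subtype H.subtype_injective
    rw [Fintype.card_fin] at h1 h2
    have h3 := aux_log_cast_le _ _ hpos h2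
    push_cast at h3
    rw [Real.logb_pow, Real.logb_self_eq_one (by norm_num), mul_one] at h3
    set m := k - k / 2 with hm
    have hm1 : 2 ≤ m := by omega
    have h4 := aux_log_fact m (by omega)
    have h5 := aux_log_cast_le _ _ (Nat.factorial_pos m) h1
    have hmk : k ≤ 2 * m := by omega
    have hmk' : (k : ℝ) ≤ 2 * m := by exact_mod_cast hmk
    have h6 : Real.logb 2 k ≤ 2 * Real.logb 2 m := by
      have : k ≤ m ^ 2 := by nlinarith
      have := aux_log_cast_le k _ (by omega) this
      push_cast at this
      rw [Real.logb_pow] at this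
      exact_mod_cast this
    have h7 : (k : ℝ) * Real.logb 2 k ≤ (2 * m) * (2 * Real.logb 2 m) :=
      mul_le_mul hmk' h6 hLk (by positivity)
    have h8 := mul_le_mul_of_nonneg_right h3 hLk
    nlinarith
  · push Not at hA
    obtain ⟨x0, y0, z0, hxy, hyz, hxz, h0⟩ := hA
    obtain ⟨a, b, ha, hb, hab, hc, hH⟩ := aux_caseB H (fun x y => by
      obtain ⟨g, hg⟩ := htr.exists_smul_eq x y
      exact ⟨g.1, g.2, hg⟩) hxy hyz hxz h0 hind
    rw [Fintype.card_fin] at hab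
    have h1 : b.factorial ^ (a - 1) ≤ H.index := by
      have e1 := aux_fact a b
      rw [hab, ← hmul] at e1
      have e2 : b.factorial ^ a = b.factorial ^ (a - 1) * b.factorial := by
        rw [← pow_succ]; congr 1; omega
      rw [e2] at e1
      have e3 : b.factorial ^ (a - 1) * (a.factorial ^ b * b.factorial) ≤
          H.index * (a.factorial ^ b * b.factorial) := by
        calc _ = b.factorial ^ (a - 1) * b.factorial * a.factorial ^ b := by ring
          _ ≤ _ := e1
          _ ≤ (a.factorial ^ b * b.factorial) * H.index := Nat.mul_le_mul_right _ hH
          _ = _ := by ring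
      exact Nat.le_of_mul_le_mul_right e3 (by positivity)
    have h2 := aux_log_cast_le _ _ (Nat.pow_pos (Nat.factorial_pos b)) h1
    have h3 := aux_log_cast_le _ _ hpos hc
    push_cast at h2 h3
    rw [Real.logb_pow] at h2 h3
    have h16 : Real.logb 2 16 = 4 := by
      rw [show (16 : ℝ) = 2 ^ 4 by norm_num, Real.logb_pow, Real.logb_self_eq_one (by norm_num)]
      norm_num
    rw [h16] at h3
    have h4 := aux_log_fact b (by omega)
    have ha' : (3 : ℝ) ≤ a := by exact_mod_cast ha
    have hb' : (2 : ℝ) ≤ b := by exact_mod_cast hb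
    have hLb : 1 ≤ Real.logb 2 b := by
      rw [Real.le_logb_iff_rpow_le (by norm_num) (by linarith)]
      simpa using hb'
    have hLa := aux_log_le a (by omega)
    have hk' : Real.logb 2 k = Real.logb 2 a + Real.logb 2 b := by
      rw [← hab, Nat.cast_mul, Real.logb_mul (by positivity) (by positivity)]
    rw [Nat.cast_sub (by omega), Nat.cast_one] at h2
    set X := Real.logb 2 H.index
    set B := Real.logb 2 b
    have h5 : (a : ℝ) / 2 * ((b : ℝ) / 2 * B) ≤ X :=
      le_trans (mul_le_mul (by linarith) h4 (by positivity) (by linarith)) h2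
    have h6 : Real.logb 2 k ≤ 2 * (a * B) := by
      rw [hk']
      nlinarith
    calc _ ≤ (b * 4 : ℝ) * (2 * (2 * (a * B))) :=
          mul_le_mul h3 (by linarith) (by linarith) (by positivity)
      _ = 64 * ((a : ℝ) / 2 * ((b : ℝ) / 2 * B)) := by ring
      _ ≤ _ := by linarith
end
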